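/- Optimality of quadratic witnesses: let Ω ∈ S₁° be a quadratic witness. Then (a) Ω is optimal — i.e. there exist no entanglement witness Ω₀, nonzero positive semidefinite Hermitian matrix P, and p ∈ (0,1) with Ω = (1−p)·Ω₀ + p·P — if and only if the vectors φ₀⊗χ₀, taken over all zeros (φ₀,χ₀) of Ω, span ℂ^(Fin Na × Fin Nb); and (b) Ω is nondecomposable optimal — i.e. there exist no entanglement witness Ω₀, positive semidefinite Hermitian matrices ρ, σ with ρ + σᴾ ≠ 0, and p ∈ (0,1) with Ω = (1−p)·Ω₀ + p·(ρ + σᴾ) — if and only if both the vectors φ₀⊗χ₀ and the partially conjugated vectors φ₀⊗χ₀*, taken over all zeros (φ₀,χ₀) of Ω, span ℂ^(Fin Na × Fin Nb). -/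

import Mathlib

open Matrix
open scoped ComplexOrder

noncomputable section

namespace EW

/-- Complex square matrices indexed by `Fin Na × Fin Nb`. -/
abbrev Mat (Na Nb : ℕ) := Matrix (Fin Na × Fin Nb) (Fin Na × Fin Nb) ℂ

/-- Kronecker product of vectors: `(φ⊗χ)_(i,j) = φ_i · χ_j`. -/
def kron {Na Nb : ℕ} (φ : Fin Na → ℂ) (χ : Fin Nb → ℂ) : Fin Na × Fin Nb → ℂ :=
  fun p => φ p.1 * χ p.2

/-- Sesquilinear pairing `xᴴ A y`. -/
def pair {n : Type*} [Fintype n] (A : Matrix n n ℂ) (x y : n → ℂ) : ℂ :=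
  star x ⬝ᵥ A.mulVec y

/-- The biquadratic form `f_A(φ,χ) = (φ⊗χ)ᴴ A (φ⊗χ)`. -/
def biquad {Na Nb : ℕ} (A : Mat Na Nb) (φ : Fin Na → ℂ) (χ : Fin Nb → ℂ) : ℂ :=
  pair A (kron φ χ) (kron φ χ)

/-- An entanglement witness: a Hermitian matrix whose biquadratic form is nonnegative. -/
def IsWitness {Na Nb : ℕ} (A : Mat Na Nb) : Prop :=
  A.IsHermitian ∧ ∀ φ χ, 0 ≤ biquad A φ χ

/-- `S₁°`, the set of trace-one entanglement witnesses. -/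
def witnessSet (Na Nb : ℕ) : Set (Mat Na Nb) :=
  { Ω | IsWitness Ω ∧ Ω.trace = 1 }

/-- A zero of a witness: a pair of nonzero vectors where the biquadratic form vanishes. -/
def IsZeroOf {Na Nb : ℕ} (Ω : Mat Na Nb) (φ₀ : Fin Na → ℂ) (χ₀ : Fin Nb → ℂ) : Prop :=
  φ₀ ≠ 0 ∧ χ₀ ≠ 0 ∧ biquad Ω φ₀ χ₀ = 0

/-- The Hessian form
`H_A(φ₀,χ₀;ξ,ζ) = Re[(ξ⊗χ₀)ᴴA(ξ⊗χ₀) + (φ₀⊗ζ)ᴴA(φ₀⊗ζ) + 2(φ₀⊗ζ)ᴴA(ξ⊗χ₀) + 2(φ₀⊗χ₀)ᴴA(ξ⊗ζ)]`. -/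
def hessForm {Na Nb : ℕ} (A : Mat Na Nb) (φ₀ : Fin Na → ℂ) (χ₀ : Fin Nb → ℂ)
    (ξ : Fin Na → ℂ) (ζ : Fin Nb → ℂ) : ℝ :=
  (pair A (kron ξ χ₀) (kron ξ χ₀) + pair A (kron φ₀ ζ) (kron φ₀ ζ)
    + 2 * pair A (kron φ₀ ζ) (kron ξ χ₀) + 2 * pair A (kron φ₀ χ₀) (kron ξ ζ)).re

/-- A Hessian zero of `Ω` at the zero `(φ₀,χ₀)`. -/
def IsHessianZeroAt {Na Nb : ℕ} (Ω : Mat Na Nb) (φ₀ : Fin Na → ℂ) (χ₀ : Fin Nb → ℂ)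
    (ξ : Fin Na → ℂ) (ζ : Fin Nb → ℂ) : Prop :=
  (ξ, ζ) ≠ (0, 0) ∧ star φ₀ ⬝ᵥ ξ = 0 ∧ star χ₀ ⬝ᵥ ζ = 0 ∧ hessForm Ω φ₀ χ₀ ξ ζ = 0

/-- A quadratic witness: a witness all of whose zeros have no Hessian zeros. -/
def IsQuadraticWitness {Na Nb : ℕ} (Ω : Mat Na Nb) : Prop :=
  IsWitness Ω ∧ ∀ φ₀ χ₀, IsZeroOf Ω φ₀ χ₀ → ∀ ξ ζ, ¬ IsHessianZeroAt Ω φ₀ χ₀ ξ ζ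

/-- Partial transpose with respect to the second factor. -/
def ptrans {Na Nb : ℕ} (A : Mat Na Nb) : Mat Na Nb :=
  fun p q => A (p.1, q.2) (q.1, p.2)

/-- Euclidean norm of a complex vector. -/
def enorm {n : Type*} [Fintype n] (x : n → ℂ) : ℝ :=
  Real.sqrt (star x ⬝ᵥ x).re

/-- Frobenius norm of a matrix. -/
def frobNorm {Na Nb : ℕ} (A : Mat Na Nb) : ℝ :=
  Real.sqrt (∑ i, ∑ j, ‖A i j‖ ^ 2)

/-- `S₁`, the set of separable states: the convex hull of normalized pure product states. -/
def sepSet (Na Nb : ℕ) : Set (Mat Na Nb) :=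
  convexHull ℝ { M | ∃ (φ : Fin Na → ℂ) (χ : Fin Nb → ℂ), enorm (kron φ χ) = 1 ∧
    M = Matrix.vecMulVec (kron φ χ) (star (kron φ χ)) }

/-- `Γ` satisfies the constraint system of the witness `Ω`. -/
def SatisfiesConstraints {Na Nb : ℕ} (Ω Γ : Mat Na Nb) : Prop :=
  (∀ φ₀ χ₀, IsZeroOf Ω φ₀ χ₀ →
    (∀ φ, pair Γ (kron φ χ₀) (kron φ₀ χ₀) = 0) ∧
    (∀ χ, pair Γ (kron φ₀ χ) (kron φ₀ χ₀) = 0)) ∧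
  (∀ φ₀ χ₀, IsZeroOf Ω φ₀ χ₀ → ∀ ξ ζ, IsHessianZeroAt Ω φ₀ χ₀ ξ ζ →
    ∀ ξ' ζ', star φ₀ ⬝ᵥ ξ' = 0 → star χ₀ ⬝ᵥ ζ' = 0 →
      hessForm Γ φ₀ χ₀ (ξ + ξ') (ζ + ζ') =
        hessForm Γ φ₀ χ₀ ξ ζ + hessForm Γ φ₀ χ₀ ξ' ζ') ∧
  (∀ φ₀ χ₀, IsZeroOf Ω φ₀ χ₀ → ∀ ξ ζ, IsHessianZeroAt Ω φ₀ χ₀ ξ ζ →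
    (pair Γ (kron φ₀ ζ) (kron ξ ζ) + pair Γ (kron ξ χ₀) (kron ξ ζ)).re = 0)

end EW

open EW

namespace EW

section Pair

variable {n : Type*} [Fintype n]

lemma pair_add_left (A : Matrix n n ℂ) (x y z : n → ℂ) :
    pair A (x + y) z = pair A x z + pair A y z := by
  simp [pair, add_dotProduct]

lemma pair_add_right (A : Matrix n n ℂ) (x y z : n → ℂ) :
    pair A x (y + z) = pair A x y + pair A x z := by
  simp [pair, mulVec_add, dotProduct_add]

lemma pair_smul_left (A : Matrix n n ℂ) (c : ℂ) (x y : n → ℂ) :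
    pair A (c • x) y = star c * pair A x y := by
  simp [pair]

lemma pair_smul_right (A : Matrix n n ℂ) (c : ℂ) (x y : n → ℂ) :
    pair A x (c • y) = c * pair A x y := by
  simp [pair, mulVec_smul]

lemma pair_add_matrix (A B : Matrix n n ℂ) (x y : n → ℂ) :
    pair (A + B) x y = pair A x y + pair B x y := by
  simp [pair, add_mulVec, dotProduct_add]

lemma pair_real_smul_matrix (c : ℝ) (A : Matrix n n ℂ) (x y : n → ℂ) :
    pair (c • A) x y = c * pair A x y := by
  simp [pair, smul_mulVec]

lemma star_pair {A : Matrix n n ℂ} (hA : A.IsHermitian) (x y : n → ℂ) :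
    star (pair A x y) = pair A y x := by
  rw [pair, pair, star_dotProduct, star_star, star_mulVec, ← dotProduct_mulVec, hA.eq]

lemma re_pair_comm {A : Matrix n n ℂ} (hA : A.IsHermitian) (x y : n → ℂ) :
    (pair A x y).re = (pair A y x).re := by
  rw [← star_pair hA x y]; simp

lemma im_pair_self {A : Matrix n n ℂ} (hA : A.IsHermitian) (x : n → ℂ) :
    (pair A x x).im = 0 := by
  have h := congrArg Complex.im (star_pair hA x x)
  simp only [Complex.star_def, Complex.conj_im] at h
  linarith

lemma continuous_pair (A : Matrix n n ℂ) :
    Continuous fun x : (n → ℂ) × (n → ℂ) => pair A x.1 x.2 := by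
  unfold pair
  fun_prop

/-- Expansion of the quadratic form of a Hermitian matrix along a parabola. -/
lemma re_pair_parabola {A : Matrix n n ℂ} (hA : A.IsHermitian) (x y z : n → ℂ) (t : ℝ) :
    (pair A (x + (t : ℂ) • y + ((t ^ 2 : ℝ) : ℂ) • z)
        (x + (t : ℂ) • y + ((t ^ 2 : ℝ) : ℂ) • z)).re =
      (pair A x x).re + t * (2 * (pair A x y).re)
        + t ^ 2 * ((pair A y y).re + 2 * (pair A x z).re + t * (2 * (pair A y z).re)
          + t ^ 2 * (pair A z z).re) := by
  simp only [pair_add_left, pair_add_right, pair_smul_left, pair_smul_right, Complex.star_def,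
    Complex.conj_ofReal, Complex.add_re, Complex.re_ofReal_mul,
    re_pair_comm hA y x, re_pair_comm hA z x, re_pair_comm hA z y]
  ring

end Pair

variable {Na Nb : ℕ}

lemma kron_smul_smul (a b : ℂ) (φ : Fin Na → ℂ) (χ : Fin Nb → ℂ) :
    kron (a • φ) (b • χ) = (a * b) • kron φ χ := by
  funext p
  simp only [kron, Pi.smul_apply, smul_eq_mul]
  ring

lemma kron_perturb (φ ξ : Fin Na → ℂ) (χ ζ : Fin Nb → ℂ) (t : ℝ) :
    kron (φ + (t : ℂ) • ξ) (χ + (t : ℂ) • ζ) =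
      kron φ χ + (t : ℂ) • (kron ξ χ + kron φ ζ) + ((t ^ 2 : ℝ) : ℂ) • kron ξ ζ := by
  funext p
  simp only [kron, Pi.add_apply, Pi.smul_apply, smul_eq_mul]
  push_cast
  ring

lemma continuous_kron :
    Continuous fun x : (Fin Na → ℂ) × (Fin Nb → ℂ) => kron x.1 x.2 := by
  unfold kron
  fun_prop

lemma continuous_re_biquad (A : Mat Na Nb) :
    Continuous fun x : (Fin Na → ℂ) × (Fin Nb → ℂ) => (biquad A x.1 x.2).re :=
  Complex.continuous_re.comp
    ((continuous_pair A).comp (continuous_kron.prodMk continuous_kron))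

lemma re_biquad_smul_smul (A : Mat Na Nb) (a b : ℂ) (φ : Fin Na → ℂ) (χ : Fin Nb → ℂ) :
    (biquad A (a • φ) (b • χ)).re = Complex.normSq (a * b) * (biquad A φ χ).re := by
  rw [biquad, kron_smul_smul, pair_smul_left, pair_smul_right, ← mul_assoc, Complex.star_def,
    ← Complex.normSq_eq_conj_mul_self, Complex.re_ofReal_mul, biquad]

lemma IsWitness.re_nonneg {A : Mat Na Nb} (hA : IsWitness A) (φ : Fin Na → ℂ)
    (χ : Fin Nb → ℂ) : 0 ≤ (biquad A φ χ).re :=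
  (Complex.le_def.1 (hA.2 φ χ)).1

lemma isWitness_iff_re_nonneg {A : Mat Na Nb} (hA : A.IsHermitian) :
    IsWitness A ↔ ∀ φ χ, 0 ≤ (biquad A φ χ).re :=
  ⟨IsWitness.re_nonneg, fun h => ⟨hA, fun φ χ =>
    Complex.le_def.2 ⟨h φ χ, (im_pair_self hA _).symm⟩⟩⟩

lemma biquad_eq_zero_of_re {A : Mat Na Nb} (hA : A.IsHermitian) {φ : Fin Na → ℂ}
    {χ : Fin Nb → ℂ} (h : (biquad A φ χ).re = 0) : biquad A φ χ = 0 :=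
  Complex.ext h (im_pair_self hA _)

/-- The second-order Taylor quotient of the biquadratic form at `(φ₀, χ₀)`. -/
def taylorQuot (A : Mat Na Nb) (φ₀ : Fin Na → ℂ) (χ₀ : Fin Nb → ℂ) (t : ℝ)
    (u : (Fin Na → ℂ) × (Fin Nb → ℂ)) : ℝ :=
  (pair A (kron u.1 χ₀ + kron φ₀ u.2) (kron u.1 χ₀ + kron φ₀ u.2)).re
    + 2 * (pair A (kron φ₀ χ₀) (kron u.1 u.2)).re
    + t * (2 * (pair A (kron u.1 χ₀ + kron φ₀ u.2) (kron u.1 u.2)).re)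
    + t ^ 2 * (pair A (kron u.1 u.2) (kron u.1 u.2)).re

lemma continuous_taylorQuot (A : Mat Na Nb) (φ₀ : Fin Na → ℂ) (χ₀ : Fin Nb → ℂ) :
    Continuous fun z : ℝ × ((Fin Na → ℂ) × (Fin Nb → ℂ)) => taylorQuot A φ₀ χ₀ z.1 z.2 := by
  unfold taylorQuot pair kron
  fun_prop

lemma taylorQuot_zero {A : Mat Na Nb} (hA : A.IsHermitian) (φ₀ : Fin Na → ℂ)
    (χ₀ : Fin Nb → ℂ) (u : (Fin Na → ℂ) × (Fin Nb → ℂ)) :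
    taylorQuot A φ₀ χ₀ 0 u = hessForm A φ₀ χ₀ u.1 u.2 := by
  have two_re (z : ℂ) : (2 * z).re = 2 * z.re := by simp
  simp only [taylorQuot, hessForm, pair_add_left, pair_add_right, Complex.add_re, two_re,
    re_pair_comm hA (kron u.1 χ₀) (kron φ₀ u.2)]
  ring

/-- A polynomial that is nonnegative on the line and vanishes at `0` has no linear term. -/
lemma linear_coeff_eq_zero {a b c d : ℝ}
    (h : ∀ t : ℝ, 0 ≤ t * a + t ^ 2 * (b + t * c + t ^ 2 * d)) : a = 0 := by
  have hmin : IsLocalMin (fun t : ℝ => t * a + t ^ 2 * (b + t * c + t ^ 2 * d)) 0 :=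
    Filter.Eventually.of_forall fun t => by simpa using h t
  have hd : HasDerivAt (fun t : ℝ => t * a + t ^ 2 * (b + t * c + t ^ 2 * d)) a 0 := by
    have h1 := ((hasDerivAt_id (0 : ℝ)).mul_const a).add (((hasDerivAt_id (0 : ℝ)).pow 2).mul
      ((((hasDerivAt_id (0 : ℝ)).mul_const c).const_add b).add
        (((hasDerivAt_id (0 : ℝ)).pow 2).mul_const d)))
    exact h1.congr_deriv (by simp)
  exact hmin.hasDerivAt_eq_zero hd

lemma IsWitness.re_biquad_perturb {A : Mat Na Nb} (hA : IsWitness A) {φ₀ : Fin Na → ℂ}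
    {χ₀ : Fin Nb → ℂ} (h0 : biquad A φ₀ χ₀ = 0) (t : ℝ)
    (u : (Fin Na → ℂ) × (Fin Nb → ℂ)) :
    (biquad A (φ₀ + (t : ℂ) • u.1) (χ₀ + (t : ℂ) • u.2)).re =
      t ^ 2 * taylorQuot A φ₀ χ₀ t u := by
  have expand (s : ℝ) : (biquad A (φ₀ + (s : ℂ) • u.1) (χ₀ + (s : ℂ) • u.2)).re =
      s * (2 * (pair A (kron φ₀ χ₀) (kron u.1 χ₀ + kron φ₀ u.2)).re)
        + s ^ 2 * taylorQuot A φ₀ χ₀ s u := by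
    have h0' : pair A (kron φ₀ χ₀) (kron φ₀ χ₀) = 0 := h0
    rw [biquad, kron_perturb, re_pair_parabola hA.1, h0', taylorQuot]
    simp
  have hlin := linear_coeff_eq_zero fun s => (hA.re_nonneg _ _).trans_eq (expand s)
  rw [expand, hlin]
  ring

/-- At a quadratic zero the Hessian form is positive on nonzero orthogonal directions. -/
lemma IsQuadraticWitness.hessForm_pos {Ω : Mat Na Nb} (hΩ : IsQuadraticWitness Ω)
    {φ₀ : Fin Na → ℂ} {χ₀ : Fin Nb → ℂ} (h0 : IsZeroOf Ω φ₀ χ₀)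
    {u : (Fin Na → ℂ) × (Fin Nb → ℂ)} (hu : u ≠ 0) (hξ : star φ₀ ⬝ᵥ u.1 = 0)
    (hζ : star χ₀ ⬝ᵥ u.2 = 0) : 0 < hessForm Ω φ₀ χ₀ u.1 u.2 := by
  refine lt_of_le_of_ne ?_ fun h => hΩ.2 _ _ h0 u.1 u.2 ⟨hu, hξ, hζ, h.symm⟩
  rw [← taylorQuot_zero hΩ.1.1]
  have hc : Continuous fun t => taylorQuot Ω φ₀ χ₀ t u := by
    unfold taylorQuot
    fun_prop
  have hlim := (hc.tendsto 0).mono_left (nhdsWithin_le_nhds (s := {0}ᶜ))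
  refine ge_of_tendsto hlim ?_
  filter_upwards [self_mem_nhdsWithin] with t ht
  have h := hΩ.1.re_biquad_perturb h0.2.2 t u
  have ht2 : 0 < t ^ 2 := sq_pos_of_ne_zero ht
  exact (mul_nonneg_iff_of_pos_left ht2).1 ((hΩ.1.re_nonneg _ _).trans_eq h)

/-- The component of `x` orthogonal to `x₀`, after rescaling so that the component along `x₀`
is `x₀` itself. -/
def orthoOffset {n : Type*} [Fintype n] (x₀ x : n → ℂ) : n → ℂ :=
  ((star x₀ ⬝ᵥ x₀) / (star x₀ ⬝ᵥ x)) • x - x₀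

section OrthoOffset

variable {n : Type*} [Fintype n] {x₀ x : n → ℂ}

lemma orthoOffset_self (h : x₀ ≠ 0) : orthoOffset x₀ x₀ = 0 := by
  have h1 : star x₀ ⬝ᵥ x₀ ≠ 0 := fun h' => h (dotProduct_star_self_eq_zero.1 h')
  simp [orthoOffset, div_self h1]

lemma dotProduct_orthoOffset (hx : star x₀ ⬝ᵥ x ≠ 0) : star x₀ ⬝ᵥ orthoOffset x₀ x = 0 := by
  simp [orthoOffset, dotProduct_sub, div_mul_cancel₀ _ hx]

lemma exists_eq_smul_add_orthoOffset (h : x₀ ≠ 0) (hx : star x₀ ⬝ᵥ x ≠ 0) :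
    ∃ a : ℂ, x = a • (x₀ + orthoOffset x₀ x) := by
  have h1 : star x₀ ⬝ᵥ x₀ ≠ 0 := fun h' => h (dotProduct_star_self_eq_zero.1 h')
  refine ⟨(star x₀ ⬝ᵥ x) / (star x₀ ⬝ᵥ x₀), ?_⟩
  rw [orthoOffset, add_sub_cancel, smul_smul, div_mul_div_cancel₀ h1, div_self hx, one_smul]

lemma continuousAt_orthoOffset (h : x₀ ≠ 0) : ContinuousAt (orthoOffset x₀) x₀ := by
  have h1 : star x₀ ⬝ᵥ x₀ ≠ 0 := fun h' => h (dotProduct_star_self_eq_zero.1 h')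
  have h2 : Continuous fun x : n → ℂ => star x₀ ⬝ᵥ x := by fun_prop
  exact ((continuousAt_const.div h2.continuousAt h1).smul continuousAt_id).sub
    continuousAt_const

lemma eventually_dotProduct_ne_zero (h : x₀ ≠ 0) : ∀ᶠ x in nhds x₀, star x₀ ⬝ᵥ x ≠ 0 := by
  have h1 : star x₀ ⬝ᵥ x₀ ≠ 0 := fun h' => h (dotProduct_star_self_eq_zero.1 h')
  have h2 : Continuous fun x : n → ℂ => star x₀ ⬝ᵥ x := by fun_prop
  exact h2.continuousAt.eventually_ne h1

end OrthoOffset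

/-- Unit directions orthogonal to a given pair of vectors. -/
def orthoSphere (φ₀ : Fin Na → ℂ) (χ₀ : Fin Nb → ℂ) : Set ((Fin Na → ℂ) × (Fin Nb → ℂ)) :=
  Metric.sphere 0 1 ∩ {u | star φ₀ ⬝ᵥ u.1 = 0 ∧ star χ₀ ⬝ᵥ u.2 = 0}

lemma isCompact_orthoSphere (φ₀ : Fin Na → ℂ) (χ₀ : Fin Nb → ℂ) :
    IsCompact (orthoSphere φ₀ χ₀) := by
  refine (isCompact_sphere _ _).inter_right (IsClosed.inter ?_ ?_)
  · exact isClosed_eq (by fun_prop) continuous_const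
  · exact isClosed_eq (by fun_prop) continuous_const

/-- Near a quadratic zero of `Ω` that is also a zero of the witness `Γ`, small multiples of the
form of `Γ` are dominated by the form of `Ω`. -/
lemma IsQuadraticWitness.eventually_mul_le {Ω Γ : Mat Na Nb} (hΩ : IsQuadraticWitness Ω)
    (hΓ : IsWitness Γ) {φ₀ : Fin Na → ℂ} {χ₀ : Fin Nb → ℂ} (h0 : IsZeroOf Ω φ₀ χ₀)
    (hΓ0 : biquad Γ φ₀ χ₀ = 0) :
    ∀ᶠ z : ℝ × ((Fin Na → ℂ) × (Fin Nb → ℂ)) in nhds (0, (φ₀, χ₀)),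
      z.1 * (biquad Γ z.2.1 z.2.2).re ≤ (biquad Ω z.2.1 z.2.2).re := by
  have hdir : ∀ᶠ s : ℝ × ℝ in nhds (0, 0), ∀ u ∈ orthoSphere φ₀ χ₀,
      s.1 * taylorQuot Γ φ₀ χ₀ s.2 u ≤ taylorQuot Ω φ₀ χ₀ s.2 u := by
    refine (isCompact_orthoSphere φ₀ χ₀).eventually_forall_of_forall_eventually
      (P := fun (s : ℝ × ℝ) u => s.1 * taylorQuot Γ φ₀ χ₀ s.2 u ≤ taylorQuot Ω φ₀ χ₀ s.2 u) fun u hu => ?_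
    have hproj : Continuous fun z : (ℝ × ℝ) × ((Fin Na → ℂ) × (Fin Nb → ℂ)) => (z.1.2, z.2) := by
      fun_prop
    have hcΓ := (continuous_taylorQuot Γ φ₀ χ₀).comp hproj
    have hcΩ := (continuous_taylorQuot Ω φ₀ χ₀).comp hproj
    have hpos : 0 < taylorQuot Ω φ₀ χ₀ 0 u := by
      rw [taylorQuot_zero hΩ.1.1]
      exact hΩ.hessForm_pos h0 (ne_zero_of_mem_unit_sphere ⟨u, hu.1⟩) hu.2.1 hu.2.2
    refine (((continuous_fst.comp continuous_fst).mul hcΓ).continuousAt.eventually_lt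
      hcΩ.continuousAt ?_).mono fun z hz => le_of_lt hz
    simpa using hpos
  let off : (Fin Na → ℂ) × (Fin Nb → ℂ) → (Fin Na → ℂ) × (Fin Nb → ℂ) :=
    fun x => (orthoOffset φ₀ x.1, orthoOffset χ₀ x.2)
  have hoff : ContinuousAt off (φ₀, χ₀) :=
    ((continuousAt_orthoOffset h0.1).comp' continuousAt_fst).prodMk
      ((continuousAt_orthoOffset h0.2.1).comp' continuousAt_snd)
  have hoff0 : off (φ₀, χ₀) = 0 := by
    simp [off, orthoOffset_self h0.1, orthoOffset_self h0.2.1]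
  have htend : Filter.Tendsto
      (fun z : ℝ × ((Fin Na → ℂ) × (Fin Nb → ℂ)) => (z.1, ‖off z.2‖))
      (nhds (0, (φ₀, χ₀))) (nhds (0, 0)) := by
    have hn : Filter.Tendsto (fun x => ‖off x‖) (nhds (φ₀, χ₀)) (nhds 0) := by
      simpa [hoff0] using hoff.norm.tendsto
    rw [nhds_prod_eq (x := (0 : ℝ)), nhds_prod_eq (x := (0 : ℝ))]
    exact Filter.tendsto_id.prodMap hn
  have hne : ∀ᶠ z : ℝ × ((Fin Na → ℂ) × (Fin Nb → ℂ)) in nhds (0, (φ₀, χ₀)),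
      star φ₀ ⬝ᵥ z.2.1 ≠ 0 ∧ star χ₀ ⬝ᵥ z.2.2 ≠ 0 :=
    (((continuous_fst.comp continuous_snd).tendsto (0, (φ₀, χ₀))).eventually
      (eventually_dotProduct_ne_zero (x₀ := φ₀) h0.1)).and
    (((continuous_snd.comp continuous_snd).tendsto (0, (φ₀, χ₀))).eventually
      (eventually_dotProduct_ne_zero (x₀ := χ₀) h0.2.1))
  filter_upwards [htend.eventually hdir, hne] with z hz hzne
  obtain ⟨ε, φ, χ⟩ := z
  dsimp only at hz hzne ⊢
  obtain ⟨a, ha⟩ := exists_eq_smul_add_orthoOffset h0.1 hzne.1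
  obtain ⟨b, hb⟩ := exists_eq_smul_add_orthoOffset h0.2.1 hzne.2
  rw [ha, hb, re_biquad_smul_smul, re_biquad_smul_smul, mul_left_comm]
  refine mul_le_mul_of_nonneg_left ?_ (Complex.normSq_nonneg _)
  set t := ‖off (φ, χ)‖ with ht
  by_cases ht0 : t = 0
  · have h00 : off (φ, χ) = 0 := norm_eq_zero.1 ht0
    have h1 : orthoOffset φ₀ φ = 0 := congrArg Prod.fst h00
    have h2 : orthoOffset χ₀ χ = 0 := congrArg Prod.snd h00
    simp [h1, h2, hΓ0, h0.2.2]
  · have htc : (t : ℂ) ≠ 0 := by exact_mod_cast ht0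
    have hmem : (t : ℂ)⁻¹ • off (φ, χ) ∈ orthoSphere φ₀ χ₀ := by
      refine ⟨?_, ?_, ?_⟩
      · rw [mem_sphere_zero_iff_norm, norm_smul, norm_inv, Complex.norm_real, ht, norm_norm]
        exact inv_mul_cancel₀ ht0
      · simp [off, dotProduct_orthoOffset hzne.1]
      · simp [off, dotProduct_orthoOffset hzne.2]
    have hscale1 : orthoOffset φ₀ φ = (t : ℂ) • ((t : ℂ)⁻¹ • off (φ, χ)).1 := by
      simp [off, smul_smul, mul_inv_cancel₀ htc]
    have hscale2 : orthoOffset χ₀ χ = (t : ℂ) • ((t : ℂ)⁻¹ • off (φ, χ)).2 := by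
      simp [off, smul_smul, mul_inv_cancel₀ htc]
    rw [hscale1, hscale2, hΓ.re_biquad_perturb hΓ0, hΩ.1.re_biquad_perturb h0.2.2, mul_left_comm]
    exact mul_le_mul_of_nonneg_left (hz _ hmem) (sq_nonneg t)

lemma biquad_zero_left (A : Mat Na Nb) (χ : Fin Nb → ℂ) : biquad A 0 χ = 0 := by
  have hk : kron (0 : Fin Na → ℂ) χ = 0 := by funext i; simp [kron]
  simp [biquad, hk, pair]

lemma biquad_zero_right (A : Mat Na Nb) (φ : Fin Na → ℂ) : biquad A φ 0 = 0 := by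
  have hk : kron φ (0 : Fin Nb → ℂ) = 0 := by funext i; simp [kron]
  simp [biquad, hk, pair]

lemma inv_norm_smul_mem_sphere {n : ℕ} {x : Fin n → ℂ} (hx : x ≠ 0) :
    (‖x‖ : ℂ)⁻¹ • x ∈ Metric.sphere (0 : Fin n → ℂ) 1 := by
  rw [mem_sphere_zero_iff_norm, norm_smul, norm_inv, Complex.norm_real, norm_norm]
  exact inv_mul_cancel₀ (norm_ne_zero_iff.2 hx)

lemma mul_re_biquad_le_of_forall_sphere {Ω Γ : Mat Na Nb} {p : ℝ}
    (h : ∀ φ ∈ Metric.sphere (0 : Fin Na → ℂ) 1, ∀ χ ∈ Metric.sphere (0 : Fin Nb → ℂ) 1,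
      p * (biquad Γ φ χ).re ≤ (biquad Ω φ χ).re) (φ : Fin Na → ℂ) (χ : Fin Nb → ℂ) :
    p * (biquad Γ φ χ).re ≤ (biquad Ω φ χ).re := by
  by_cases hφ : φ = 0
  · simp [hφ, biquad_zero_left]
  by_cases hχ : χ = 0
  · simp [hχ, biquad_zero_right]
  have hφn : (‖φ‖ : ℂ) ≠ 0 := by exact_mod_cast norm_ne_zero_iff.2 hφ
  have hχn : (‖χ‖ : ℂ) ≠ 0 := by exact_mod_cast norm_ne_zero_iff.2 hχ
  have hle := h _ (inv_norm_smul_mem_sphere hφ) _ (inv_norm_smul_mem_sphere hχ)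
  rw [re_biquad_smul_smul, re_biquad_smul_smul, mul_left_comm p] at hle
  exact le_of_mul_le_mul_left hle
    (Complex.normSq_pos.2 (mul_ne_zero (inv_ne_zero hφn) (inv_ne_zero hχn)))

lemma IsQuadraticWitness.eventually_forall_sphere {Ω Γ : Mat Na Nb} (hΩ : IsQuadraticWitness Ω)
    (hΓ : IsWitness Γ) (hzero : ∀ φ₀ χ₀, IsZeroOf Ω φ₀ χ₀ → biquad Γ φ₀ χ₀ = 0) :
    ∀ᶠ p : ℝ in nhds 0,
      ∀ x ∈ Metric.sphere (0 : Fin Na → ℂ) 1 ×ˢ Metric.sphere (0 : Fin Nb → ℂ) 1,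
        p * (biquad Γ x.1 x.2).re ≤ (biquad Ω x.1 x.2).re := by
  refine ((isCompact_sphere _ _).prod (isCompact_sphere _ _)).eventually_forall_of_forall_eventually
    (P := fun p x => p * (biquad Γ x.1 x.2).re ≤ (biquad Ω x.1 x.2).re) ?_
  rintro ⟨φ, χ⟩ ⟨hφ, hχ⟩
  rcases (hΩ.1.re_nonneg φ χ).eq_or_lt with h | h
  · have h0 : IsZeroOf Ω φ χ := ⟨ne_zero_of_mem_unit_sphere ⟨φ, hφ⟩,
      ne_zero_of_mem_unit_sphere ⟨χ, hχ⟩, biquad_eq_zero_of_re hΩ.1.1 h.symm⟩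
    exact hΩ.eventually_mul_le hΓ h0 (hzero _ _ h0)
  · have hcΓ := (continuous_re_biquad Γ).comp
      (continuous_snd (X := ℝ) (Y := (Fin Na → ℂ) × (Fin Nb → ℂ)))
    have hcΩ := (continuous_re_biquad Ω).comp
      (continuous_snd (X := ℝ) (Y := (Fin Na → ℂ) × (Fin Nb → ℂ)))
    refine ((continuous_fst.mul hcΓ).continuousAt.eventually_lt
      hcΩ.continuousAt ?_).mono fun z hz => le_of_lt hz
    simpa using h

/-- A witness vanishing on all zeros of a quadratic witness `Ω` is, up to a small positive factor,
dominated by `Ω`. -/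
lemma IsQuadraticWitness.exists_mul_le {Ω Γ : Mat Na Nb} (hΩ : IsQuadraticWitness Ω)
    (hΓ : IsWitness Γ) (hzero : ∀ φ₀ χ₀, IsZeroOf Ω φ₀ χ₀ → biquad Γ φ₀ χ₀ = 0) :
    ∃ p : ℝ, 0 < p ∧ p < 1 ∧ ∀ φ χ, p * (biquad Γ φ χ).re ≤ (biquad Ω φ χ).re := by
  obtain ⟨δ, hδ, hball⟩ := Metric.eventually_nhds_iff.1 (hΩ.eventually_forall_sphere hΓ hzero)
  have hp0 : 0 < min (δ / 2) (1 / 2) := by positivity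
  have hpδ : min (δ / 2) (1 / 2) ≤ δ / 2 := min_le_left _ _
  have hp1 : min (δ / 2) (1 / 2) ≤ 1 / 2 := min_le_right _ _
  refine ⟨min (δ / 2) (1 / 2), hp0, by linarith,
    mul_re_biquad_le_of_forall_sphere fun φ hφ χ hχ => hball ?_ (φ, χ) ⟨hφ, hχ⟩⟩
  rw [Real.dist_eq, sub_zero, abs_of_pos hp0]
  linarith

lemma IsQuadraticWitness.exists_decomposition {Ω Γ : Mat Na Nb} (hΩ : IsQuadraticWitness Ω)
    (hΓ : IsWitness Γ) (hzero : ∀ φ₀ χ₀, IsZeroOf Ω φ₀ χ₀ → biquad Γ φ₀ χ₀ = 0) :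
    ∃ (Ω₀ : Mat Na Nb) (p : ℝ), IsWitness Ω₀ ∧ 0 < p ∧ p < 1 ∧
      Ω = (1 - p) • Ω₀ + p • Γ := by
  obtain ⟨p, hp0, hp1, hp⟩ := hΩ.exists_mul_le hΓ hzero
  have hq : 0 < 1 - p := sub_pos.2 hp1
  have hherm (c : ℝ) {A : Mat Na Nb} (hA : A.IsHermitian) : (c • A).IsHermitian := by
    rw [Matrix.IsHermitian, conjTranspose_smul, hA.eq, star_trivial]
  refine ⟨(1 - p)⁻¹ • (Ω + (-p) • Γ), p, ?_, hp0, hp1, ?_⟩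
  · refine (isWitness_iff_re_nonneg (hherm _ (hΩ.1.1.add (hherm _ hΓ.1)))).2 fun φ χ => ?_
    have h := hp φ χ
    rw [biquad, pair_real_smul_matrix, pair_add_matrix, pair_real_smul_matrix,
      Complex.re_ofReal_mul, Complex.add_re, Complex.re_ofReal_mul]
    refine mul_nonneg (inv_nonneg.2 hq.le) ?_
    unfold biquad at h
    linarith
  · rw [smul_smul, mul_inv_cancel₀ hq.ne', one_smul, neg_smul, neg_add_cancel_right]

lemma isWitness_of_posSemidef {P : Mat Na Nb} (hP : P.PosSemidef) : IsWitness P :=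
  ⟨hP.1, fun φ χ => hP.dotProduct_mulVec_nonneg (kron φ χ)⟩

lemma ptrans_ptrans (A : Mat Na Nb) : ptrans (ptrans A) = A := rfl

lemma isHermitian_ptrans {A : Mat Na Nb} (hA : A.IsHermitian) : (ptrans A).IsHermitian := by
  ext p q
  exact hA.apply (p.1, q.2) (q.1, p.2)

lemma biquad_ptrans (A : Mat Na Nb) (φ : Fin Na → ℂ) (χ : Fin Nb → ℂ) :
    biquad (ptrans A) φ χ = biquad A φ (star χ) := by
  simp only [biquad, pair, dotProduct, mulVec, kron, ptrans, Fintype.sum_prod_type, Pi.star_apply,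
    Finset.mul_sum, star_mul', star_star]
  refine Finset.sum_congr rfl fun i _ => ?_
  rw [Finset.sum_comm]
  conv_rhs => rw [Finset.sum_comm]
  refine Finset.sum_congr rfl fun k _ => ?_
  rw [Finset.sum_comm]
  refine Finset.sum_congr rfl fun j _ => Finset.sum_congr rfl fun l _ => ?_
  ring

lemma isWitness_ptrans_of_posSemidef {P : Mat Na Nb} (hP : P.PosSemidef) :
    IsWitness (ptrans P) :=
  ⟨isHermitian_ptrans hP.1, fun φ χ => by
    rw [biquad_ptrans]; exact (isWitness_of_posSemidef hP).2 _ _⟩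

/-- A subset that does not span is annihilated by a nonzero positive semidefinite matrix. -/
lemma exists_posSemidef_of_span_ne_top {n : Type*} [Fintype n] {S : Set (n → ℂ)}
    (hS : Submodule.span ℂ S ≠ ⊤) :
    ∃ P : Matrix n n ℂ, P.PosSemidef ∧ P ≠ 0 ∧ ∀ v ∈ S, pair P v v = 0 := by
  classical
  obtain ⟨f, hf, hle⟩ := Submodule.exists_le_ker_of_lt_top _ (lt_top_iff_ne_top.2 hS)
  have hfx (x : n → ℂ) : f x = (fun i => f (Pi.single i 1)) ⬝ᵥ x := by
    conv_lhs => rw [pi_eq_sum_univ' x, map_sum]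
    exact Finset.sum_congr rfl fun i _ => by
      rw [map_smul, smul_eq_mul, mul_comm]
  set g : n → ℂ := fun i => f (Pi.single i 1)
  refine ⟨vecMulVec (star g) g, posSemidef_vecMulVec_star_self g, fun h => hf ?_, fun v hv => ?_⟩
  · have hg : g = 0 := by
      funext i
      have := congrFun (congrFun h i) i
      simpa [vecMulVec_apply] using this
    ext x
    simp [hfx, hg]
  · have h0 : g ⬝ᵥ v = 0 := by
      rw [← hfx]; exact hle (Submodule.subset_span hv)
    rw [pair, vecMulVec_mulVec, h0]
    simp

/-- A positive semidefinite matrix whose form vanishes on a spanning set is zero. -/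
lemma posSemidef_eq_zero_of_span_eq_top {n : Type*} [Fintype n] {P : Matrix n n ℂ}
    (hP : P.PosSemidef) {S : Set (n → ℂ)} (hS : Submodule.span ℂ S = ⊤)
    (h : ∀ v ∈ S, pair P v v = 0) : P = 0 := by
  classical
  have hker : Submodule.span ℂ S ≤ LinearMap.ker P.mulVecLin :=
    Submodule.span_le.2 fun v hv => (hP.dotProduct_mulVec_zero_iff v).1 (h v hv)
  rw [hS, top_le_iff, LinearMap.ker_eq_top] at hker
  exact Matrix.toLin'.injective (by rw [map_zero]; exact hker)

/-- If `Ω` is a proper convex combination of two witnesses, its zeros are zeros of both. -/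
lemma biquad_eq_zero_of_decomposition {Ω Ω₀ Γ : Mat Na Nb} {p : ℝ} (hΩ₀ : IsWitness Ω₀)
    (hΓ : IsWitness Γ) (hp0 : 0 < p) (hp1 : p < 1) (h : Ω = (1 - p) • Ω₀ + p • Γ)
    {φ₀ : Fin Na → ℂ} {χ₀ : Fin Nb → ℂ} (h0 : IsZeroOf Ω φ₀ χ₀) : biquad Γ φ₀ χ₀ = 0 := by
  refine biquad_eq_zero_of_re hΓ.1 (le_antisymm ?_ (hΓ.re_nonneg _ _))
  have hz := congrArg Complex.re h0.2.2
  rw [h, biquad, pair_add_matrix, pair_real_smul_matrix, pair_real_smul_matrix, Complex.add_re,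
    Complex.re_ofReal_mul, Complex.re_ofReal_mul, Complex.zero_re] at hz
  have h1 : 0 ≤ (1 - p) * (pair Ω₀ (kron φ₀ χ₀) (kron φ₀ χ₀)).re :=
    mul_nonneg (sub_pos.2 hp1).le (hΩ₀.re_nonneg φ₀ χ₀)
  exact nonpos_of_mul_nonpos_right (a := p) (by unfold biquad; linarith) hp0

lemma IsWitness.add {A B : Mat Na Nb} (hA : IsWitness A) (hB : IsWitness B) :
    IsWitness (A + B) :=
  ⟨hA.1.add hB.1, fun φ χ => by
    rw [biquad, pair_add_matrix]; exact add_nonneg (hA.2 φ χ) (hB.2 φ χ)⟩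

end EW

theorem quadratic_witness_optimality (Na Nb : ℕ) (Ω : Mat Na Nb)
    (hΩ : Ω ∈ witnessSet Na Nb) (hquad : IsQuadraticWitness Ω) :
    ((¬ ∃ (Ω₀ P : Mat Na Nb) (p : ℝ), IsWitness Ω₀ ∧ P.PosSemidef ∧ P ≠ 0 ∧
        0 < p ∧ p < 1 ∧ Ω = (1 - p) • Ω₀ + p • P) ↔
      Submodule.span ℂ { v : Fin Na × Fin Nb → ℂ |
        ∃ φ₀ χ₀, IsZeroOf Ω φ₀ χ₀ ∧ v = kron φ₀ χ₀ } = ⊤) ∧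
    ((¬ ∃ (Ω₀ ρ σ : Mat Na Nb) (p : ℝ), IsWitness Ω₀ ∧ ρ.PosSemidef ∧ σ.PosSemidef ∧
        ρ + ptrans σ ≠ 0 ∧ 0 < p ∧ p < 1 ∧ Ω = (1 - p) • Ω₀ + p • (ρ + ptrans σ)) ↔
      (Submodule.span ℂ { v : Fin Na × Fin Nb → ℂ |
          ∃ φ₀ χ₀, IsZeroOf Ω φ₀ χ₀ ∧ v = kron φ₀ χ₀ } = ⊤ ∧
       Submodule.span ℂ { v : Fin Na × Fin Nb → ℂ |
          ∃ φ₀ χ₀, IsZeroOf Ω φ₀ χ₀ ∧ v = kron φ₀ (star χ₀) } = ⊤)) := by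
  refine ⟨⟨fun hopt => ?_, ?_⟩, ⟨fun hopt => ⟨?_, ?_⟩, ?_⟩⟩
  · by_contra hspan
    obtain ⟨P, hP, hP0, hv⟩ := exists_posSemidef_of_span_ne_top hspan
    obtain ⟨Ω₀, p, hΩ₀, hp0, hp1, h⟩ := hquad.exists_decomposition (isWitness_of_posSemidef hP)
      fun φ₀ χ₀ h0 => hv _ ⟨φ₀, χ₀, h0, rfl⟩
    exact hopt ⟨Ω₀, P, p, hΩ₀, hP, hP0, hp0, hp1, h⟩
  · rintro hspan ⟨Ω₀, P, p, hΩ₀, hP, hP0, hp0, hp1, h⟩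
    refine hP0 (posSemidef_eq_zero_of_span_eq_top hP hspan ?_)
    rintro _ ⟨φ₀, χ₀, h0, rfl⟩
    exact biquad_eq_zero_of_decomposition hΩ₀ (isWitness_of_posSemidef hP) hp0 hp1 h h0
  · by_contra hspan
    obtain ⟨P, hP, hP0, hv⟩ := exists_posSemidef_of_span_ne_top hspan
    obtain ⟨Ω₀, p, hΩ₀, hp0, hp1, h⟩ := hquad.exists_decomposition (isWitness_of_posSemidef hP)
      fun φ₀ χ₀ h0 => hv _ ⟨φ₀, χ₀, h0, rfl⟩
    have hadd : P + ptrans 0 = P := add_zero P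
    exact hopt ⟨Ω₀, P, 0, p, hΩ₀, hP, .zero, by rwa [hadd], hp0, hp1, by rwa [hadd]⟩
  · by_contra hspan
    obtain ⟨P, hP, hP0, hv⟩ := exists_posSemidef_of_span_ne_top hspan
    obtain ⟨Ω₀, p, hΩ₀, hp0, hp1, h⟩ := hquad.exists_decomposition
      (isWitness_ptrans_of_posSemidef hP)
      fun φ₀ χ₀ h0 => (biquad_ptrans P φ₀ χ₀).trans (hv _ ⟨φ₀, χ₀, h0, rfl⟩)
    refine hopt ⟨Ω₀, 0, P, p, hΩ₀, .zero, hP, fun h0 => hP0 ?_, hp0, hp1, by rwa [zero_add]⟩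
    rw [zero_add] at h0
    rw [← ptrans_ptrans P, h0]
    rfl
  · rintro ⟨hspan, hspan'⟩ ⟨Ω₀, ρ, σ, p, hΩ₀, hρ, hσ, hne, hp0, hp1, h⟩
    have hwρ := isWitness_of_posSemidef hρ
    have hwσ := isWitness_ptrans_of_posSemidef hσ
    have hsum {φ₀ : Fin Na → ℂ} {χ₀ : Fin Nb → ℂ} (h0 : IsZeroOf Ω φ₀ χ₀) :
        biquad ρ φ₀ χ₀ = 0 ∧ biquad (ptrans σ) φ₀ χ₀ = 0 := by
      have hz := biquad_eq_zero_of_decomposition hΩ₀ (hwρ.add hwσ) hp0 hp1 h h0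
      rw [biquad, pair_add_matrix] at hz
      exact (add_eq_zero_iff_of_nonneg (hwρ.2 φ₀ χ₀) (hwσ.2 φ₀ χ₀)).1 hz
    have hρ0 : ρ = 0 := by
      refine posSemidef_eq_zero_of_span_eq_top hρ hspan ?_
      rintro _ ⟨φ₀, χ₀, h0, rfl⟩
      exact (hsum h0).1
    have hσ0 : σ = 0 := by
      refine posSemidef_eq_zero_of_span_eq_top hσ hspan' ?_
      rintro _ ⟨φ₀, χ₀, h0, rfl⟩
      exact (biquad_ptrans σ φ₀ χ₀).symm.trans (hsum h0).2
    apply hne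
    rw [hρ0, hσ0, zero_add]
    rfl
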